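/- Let E, F be finite-dimensional real inner product spaces, f : E × F → ℝ continuously differentiable, g^R : E → (F_R)^{m_R} and g^Q : F → (F_Q)^{m_Q} continuously differentiable, and define Φ(x, z) = f(x, z) + Σ_{i=1}^{m_R} ‖g^R_i(x)‖ + Σ_{j=1}^{m_Q} ‖g^Q_j(z)‖ and its smoothing Φ_ε(x, z) = f(x, z) + Σ_i H_ε(g^R_i(x)) + Σ_j H_ε(g^Q_j(z)). Suppose (x_j, z_j) → (x̄, z̄) in E × F, ε_j > 0 with ε_j → 0, and ‖∇Φ_{ε_j}(x_j, z_j)‖ → 0 (for instance ‖∇Φ_{ε_j}(x_j, z_j)‖ ≤ σε_j for some σ > 0). Then (x̄, z̄) is a Clarke stationary point of Φ, i.e. 0 ∈ ∂^c Φ(x̄, z̄). -/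

import Mathlib

/-- The smoothed norm `H_ε(y) = ‖y‖²/(2ε)` if `‖y‖ ≤ ε`, and `‖y‖ - ε/2` otherwise. -/
noncomputable def smoothedNorm {F : Type*} [NormedAddCommGroup F] (ε : ℝ) (y : F) : ℝ :=
  if ‖y‖ ≤ ε then ‖y‖ ^ 2 / (2 * ε) else ‖y‖ - ε / 2

/-- The Clarke generalized directional derivative of a two-block function at `(x, z)` in
direction `(r, s)`: `f°(x,z; r,s) = limsup_{(c,d) → (x,z), t ↓ 0} (f(c+tr, d+ts) − f(c,d))/t`. -/
noncomputable def clarkeDeriv2 {E F : Type*}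
    [NormedAddCommGroup E] [NormedSpace ℝ E] [NormedAddCommGroup F] [NormedSpace ℝ F]
    (f : E → F → ℝ) (x : E) (z : F) (r : E) (s : F) : ℝ :=
  Filter.limsup
    (fun p : (E × F) × ℝ => (f (p.1.1 + p.2 • r) (p.1.2 + p.2 • s) - f p.1.1 p.1.2) / p.2)
    ((nhds (x, z)) ×ˢ (nhdsWithin 0 (Set.Ioi 0)))

section SmoothedNorm

variable {Y : Type*} [NormedAddCommGroup Y]

/-- The smoothed norm is the Moreau envelope of the norm: it is bounded by every competitor. -/
theorem smoothedNorm_le_norm_add {ε : ℝ} (hε : 0 < ε) (y u : Y) :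
    smoothedNorm ε y ≤ ‖u‖ + ‖y - u‖ ^ 2 / (2 * ε) := by
  have h1 : ‖y‖ ≤ ‖u‖ + ‖y - u‖ := by simpa using norm_add_le u (y - u)
  have hu := norm_nonneg u
  have hm := norm_nonneg (y - u)
  have hy := norm_nonneg y
  generalize ‖y - u‖ = m at *
  unfold smoothedNorm
  split_ifs with h
  · rw [← sub_nonneg]
    have : ‖u‖ + m ^ 2 / (2 * ε) - ‖y‖ ^ 2 / (2 * ε)
        = (2 * ε * ‖u‖ + m ^ 2 - ‖y‖ ^ 2) / (2 * ε) := by field_simp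
    rw [this]
    apply div_nonneg _ (by positivity)
    rcases le_total ‖y‖ m with hmn | hmn
    · nlinarith [mul_nonneg hε.le hu]
    · nlinarith [mul_nonneg (sub_nonneg.2 hmn) (by linarith : 0 ≤ 2 * ε - (‖y‖ + m)),
        mul_nonneg hε.le (by linarith : 0 ≤ ‖u‖ + m - ‖y‖)]
  · rw [← sub_nonneg]
    have : ‖u‖ + m ^ 2 / (2 * ε) - (‖y‖ - ε / 2)
        = (‖u‖ + m - ‖y‖) + (m - ε) ^ 2 / (2 * ε) := by field_simp; ring
    rw [this]
    have : 0 ≤ (m - ε) ^ 2 / (2 * ε) := by positivity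
    linarith

theorem smoothedNorm_le_norm {ε : ℝ} (hε : 0 < ε) (y : Y) : smoothedNorm ε y ≤ ‖y‖ := by
  simpa using smoothedNorm_le_norm_add hε y y

theorem norm_sub_le_smoothedNorm {ε : ℝ} (hε : 0 < ε) (y : Y) :
    ‖y‖ - ε / 2 ≤ smoothedNorm ε y := by
  unfold smoothedNorm
  split_ifs with h
  · have : ‖y‖ ^ 2 / (2 * ε) - (‖y‖ - ε / 2) = (‖y‖ - ε) ^ 2 / (2 * ε) := by
      field_simp; ring
    have : 0 ≤ (‖y‖ - ε) ^ 2 / (2 * ε) := by positivity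
    linarith
  · exact le_rfl

variable [InnerProductSpace ℝ Y]

/-- The smoothed norm dominates its affine minorants with slopes in the unit ball. -/
theorem inner_sub_le_smoothedNorm {ε : ℝ} (hε : 0 < ε) (y : Y) {p : Y} (hp : ‖p‖ ≤ 1) :
    inner ℝ p y - ε / 2 * ‖p‖ ^ 2 ≤ smoothedNorm ε y := by
  have h1 := real_inner_le_norm p y
  have hp0 := norm_nonneg p
  unfold smoothedNorm
  split_ifs with h
  · have : ‖y‖ ^ 2 / (2 * ε) - (‖p‖ * ‖y‖ - ε / 2 * ‖p‖ ^ 2)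
        = (‖y‖ - ε * ‖p‖) ^ 2 / (2 * ε) := by field_simp; ring
    have : 0 ≤ (‖y‖ - ε * ‖p‖) ^ 2 / (2 * ε) := by positivity
    linarith
  · nlinarith [mul_nonneg (sub_nonneg.2 hp) (sub_nonneg.2 (not_le.1 h).le),
      mul_nonneg hε.le (sq_nonneg (1 - ‖p‖))]

/-- At each point both variational descriptions of the smoothed norm are attained by the same
slope. -/
theorem exists_smoothedNorm_eq {ε : ℝ} (hε : 0 < ε) (y : Y) :
    ∃ p : Y, ‖p‖ ≤ 1 ∧ smoothedNorm ε y = inner ℝ p y - ε / 2 * ‖p‖ ^ 2 ∧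
      smoothedNorm ε y = ‖y - ε • p‖ + ‖ε • p‖ ^ 2 / (2 * ε) := by
  by_cases h : ‖y‖ ≤ ε
  · have hn : ‖ε⁻¹ • y‖ = ε⁻¹ * ‖y‖ := by
      rw [norm_smul, Real.norm_of_nonneg (by positivity)]
    refine ⟨ε⁻¹ • y, ?_, ?_, ?_⟩
    · rw [hn, inv_mul_le_iff₀ hε]; simpa using h
    · rw [smoothedNorm, if_pos h, hn, real_inner_smul_left, real_inner_self_eq_norm_sq]
      field_simp; ring
    · rw [smoothedNorm, if_pos h, smul_inv_smul₀ hε.ne']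
      simp
  · have hlt := not_le.1 h
    have hy : 0 < ‖y‖ := hε.trans hlt
    have hn : ‖‖y‖⁻¹ • y‖ = 1 := by
      rw [norm_smul, norm_inv, norm_norm, inv_mul_cancel₀ hy.ne']
    refine ⟨‖y‖⁻¹ • y, hn.le, ?_, ?_⟩
    · rw [smoothedNorm, if_neg h, hn, real_inner_smul_left, real_inner_self_eq_norm_sq]
      field_simp
    · have h2 : y - ε • ‖y‖⁻¹ • y = (1 - ε * ‖y‖⁻¹) • y := by
        rw [sub_smul, one_smul, mul_smul]
      have h3 : 0 ≤ 1 - ε * ‖y‖⁻¹ := by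
        rw [sub_nonneg, mul_inv_le_iff₀ hy]; linarith
      rw [smoothedNorm, if_neg h, h2, norm_smul, norm_smul, hn, Real.norm_of_nonneg h3,
        Real.norm_of_nonneg hε.le]
      field_simp; ring

/-- The smoothed norm is differentiable, and its derivative is a subgradient. -/
theorem exists_hasFDerivAt_smoothedNorm {ε : ℝ} (hε : 0 < ε) (y : Y) :
    ∃ L : Y →L[ℝ] ℝ, HasFDerivAt (smoothedNorm ε) L y ∧
      ∀ y', smoothedNorm ε y + L (y' - y) ≤ smoothedNorm ε y' := by
  obtain ⟨p, hp, h1, h2⟩ := exists_smoothedNorm_eq hε y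
  have hlow : ∀ y', smoothedNorm ε y + innerSL ℝ p (y' - y) ≤ smoothedNorm ε y' := by
    intro y'
    have := inner_sub_le_smoothedNorm hε y' hp
    rw [innerSL_apply_apply, inner_sub_right]
    linarith
  have hup : ∀ y', smoothedNorm ε y' - smoothedNorm ε y - innerSL ℝ p (y' - y)
      ≤ (2 * ε)⁻¹ * ‖y' - y‖ ^ 2 := by
    intro y'
    have h3 := smoothedNorm_le_norm_add hε y' (y - ε • p)
    have h4 : y' - (y - ε • p) = (y' - y) + ε • p := by abel
    rw [h4, norm_add_sq_real, real_inner_smul_right, real_inner_comm] at h3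
    rw [innerSL_apply_apply]
    have h5 : (‖y' - y‖ ^ 2 + 2 * (ε * inner ℝ p (y' - y)) + ‖ε • p‖ ^ 2) / (2 * ε)
        = (2 * ε)⁻¹ * ‖y' - y‖ ^ 2 + inner ℝ p (y' - y) + ‖ε • p‖ ^ 2 / (2 * ε) := by
      field_simp
    linarith
  refine ⟨innerSL ℝ p, .of_isLittleO ?_, hlow⟩
  refine Asymptotics.IsBigO.trans_isLittleO (g := fun y' => ‖y' - y‖ ^ 2)
    (.of_bound (2 * ε)⁻¹ (.of_forall fun y' => ?_))
    (Asymptotics.isLittleO_pow_sub_sub y one_lt_two)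
  rw [Real.norm_of_nonneg (by linarith [hlow y']), norm_pow, norm_norm]
  exact hup y'

variable {X : Type*} [NormedAddCommGroup X] [NormedSpace ℝ X]

theorem DifferentiableAt.smoothedNorm_comp {ε : ℝ} (hε : 0 < ε) {g : X → Y} {x : X}
    (hg : DifferentiableAt ℝ g x) : DifferentiableAt ℝ (fun w => smoothedNorm ε (g w)) x :=
  let ⟨_, hL, _⟩ := exists_hasFDerivAt_smoothedNorm hε (g x)
  (hL.comp x hg.hasFDerivAt).differentiableAt

/-- The directional derivative of `H_ε ∘ g` is controlled by difference quotients of the norm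
along the linearization of `g`. -/
theorem mul_fderiv_smoothedNorm_comp_le {ε : ℝ} (hε : 0 < ε) {g : X → Y} {x : X}
    (hg : DifferentiableAt ℝ g x) (r : X) (t : ℝ) :
    t * fderiv ℝ (fun w => smoothedNorm ε (g w)) x r
      ≤ ‖g x + t • fderiv ℝ g x r‖ - ‖g x‖ + ε / 2 := by
  obtain ⟨L, hL, hsub⟩ := exists_hasFDerivAt_smoothedNorm hε (g x)
  have hcomp : fderiv ℝ (fun w => smoothedNorm ε (g w)) x = L.comp (fderiv ℝ g x) :=
    (hL.comp x hg.hasFDerivAt).fderiv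
  have h1 := hsub (g x + t • fderiv ℝ g x r)
  rw [add_sub_cancel_left, map_smul, smul_eq_mul] at h1
  rw [hcomp, ContinuousLinearMap.comp_apply]
  linarith [smoothedNorm_le_norm hε (g x + t • fderiv ℝ g x r),
    norm_sub_le_smoothedNorm hε (g x)]

end SmoothedNorm

section LinearizationError

open Filter Topology

variable {X Y : Type*} [NormedAddCommGroup X] [NormedSpace ℝ X]
  [NormedAddCommGroup Y] [NormedSpace ℝ Y]

theorem DifferentiableAt.tendsto_linearization_error {g : X → Y} {x : X}
    (hg : DifferentiableAt ℝ g x) (r : X) :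
    Tendsto (fun t : ℝ => t⁻¹ • (g (x + t • r) - (g x + t • fderiv ℝ g x r)))
      (𝓝[>] 0) (𝓝 0) := by
  have h := (hg.hasFDerivAt.hasLineDerivAt r).tendsto_slope_zero_right
  have h' := h.sub_const (fderiv ℝ g x r)
  rw [sub_self] at h'
  refine h'.congr' ?_
  filter_upwards [self_mem_nhdsWithin] with t ht
  rw [← sub_sub, smul_sub t⁻¹ _ (t • _), inv_smul_smul₀ (ne_of_gt ht)]

/-- Replacing a map by its linearization changes difference quotients of its norm by `o(1)`. -/
theorem DifferentiableAt.tendsto_norm_linearization_error {g : X → Y} {x : X}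
    (hg : DifferentiableAt ℝ g x) (r : X) :
    Tendsto (fun t : ℝ => t⁻¹ * (‖g (x + t • r)‖ - ‖g x + t • fderiv ℝ g x r‖))
      (𝓝[>] 0) (𝓝 0) := by
  refine squeeze_zero_norm (fun t => ?_)
    (tendsto_zero_iff_norm_tendsto_zero.1 (hg.tendsto_linearization_error r))
  rw [norm_smul, norm_mul]
  gcongr
  exact abs_norm_sub_norm_le _ _

end LinearizationError

open Filter Topology

/-- Accumulation points of iterates along which the smoothed gradients vanish and the
smoothing parameters tend to zero are Clarke stationary points of the dual-domain
objective `Φ(x,z) = f(x,z) + Σᵢ ‖g^R_i(x)‖ + Σⱼ ‖g^Q_j(z)‖`. -/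
theorem accumulation_point_clarke_stationary
    {E F FR FQ : Type*}
    [NormedAddCommGroup E] [InnerProductSpace ℝ E] [FiniteDimensional ℝ E]
    [NormedAddCommGroup F] [InnerProductSpace ℝ F] [FiniteDimensional ℝ F]
    [NormedAddCommGroup FR] [InnerProductSpace ℝ FR] [FiniteDimensional ℝ FR]
    [NormedAddCommGroup FQ] [InnerProductSpace ℝ FQ] [FiniteDimensional ℝ FQ]
    (f : E → F → ℝ) (hf : ContDiff ℝ 1 (fun p : E × F => f p.1 p.2))
    {mR mQ : ℕ} (gR : Fin mR → E → FR) (hgR : ∀ i, ContDiff ℝ 1 (gR i))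
    (gQ : Fin mQ → F → FQ) (hgQ : ∀ j, ContDiff ℝ 1 (gQ j))
    (Φ : E → F → ℝ) (hΦ : Φ = fun x z => f x z + ∑ i, ‖gR i x‖ + ∑ j, ‖gQ j z‖)
    (Φε : ℝ → E → F → ℝ)
    (hΦε : Φε = fun ε x z =>
      f x z + ∑ i, smoothedNorm ε (gR i x) + ∑ j, smoothedNorm ε (gQ j z))
    (xs : ℕ → E) (zs : ℕ → F) (xbar : E) (zbar : F)
    (hxz : Filter.Tendsto (fun j => (xs j, zs j)) Filter.atTop (nhds (xbar, zbar)))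
    (εs : ℕ → ℝ) (hεpos : ∀ j, 0 < εs j)
    (hε0 : Filter.Tendsto εs Filter.atTop (nhds 0))
    (hgrad : Filter.Tendsto
      (fun j => Real.sqrt
        (‖gradient (fun w => Φε (εs j) w (zs j)) (xs j)‖ ^ 2 +
         ‖gradient (fun w => Φε (εs j) (xs j) w) (zs j)‖ ^ 2))
      Filter.atTop (nhds 0)) :
    ∀ (r : E) (s : F), 0 ≤ clarkeDeriv2 Φ xbar zbar r s := by
  subst hΦ hΦε
  intro r s
  have hfd : Differentiable ℝ (fun p : E × F => f p.1 p.2) := hf.differentiable one_ne_zero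
  have hgRd : ∀ i, Differentiable ℝ (gR i) := fun i => (hgR i).differentiable one_ne_zero
  have hgQd : ∀ j, Differentiable ℝ (gQ j) := fun j => (hgQ j).differentiable one_ne_zero
  have hx : Tendsto xs atTop (𝓝 xbar) := (continuous_fst.tendsto _).comp hxz
  have hz : Tendsto zs atTop (𝓝 zbar) := (continuous_snd.tendsto _).comp hxz
  set Df := fderiv ℝ (fun p : E × F => f p.1 p.2)
  -- Any linearized descent of `Φ` at the limit point would persist for the smoothed gradients.
  have key : ∀ t : ℝ, 0 < t → 0 ≤ t * Df (xbar, zbar) (r, s)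
      + ∑ i, (‖gR i xbar + t • fderiv ℝ (gR i) xbar r‖ - ‖gR i xbar‖)
      + ∑ j, (‖gQ j zbar + t • fderiv ℝ (gQ j) zbar s‖ - ‖gQ j zbar‖) := by
    intro t ht
    have hlim : Tendsto (fun k => t * Df (xs k, zs k) (r, s)
        + ∑ i, (‖gR i (xs k) + t • fderiv ℝ (gR i) (xs k) r‖ - ‖gR i (xs k)‖ + εs k / 2)
        + ∑ j, (‖gQ j (zs k) + t • fderiv ℝ (gQ j) (zs k) s‖ - ‖gQ j (zs k)‖ + εs k / 2))
        atTop (𝓝 (t * Df (xbar, zbar) (r, s)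
        + ∑ i, (‖gR i xbar + t • fderiv ℝ (gR i) xbar r‖ - ‖gR i xbar‖ + 0 / 2)
        + ∑ j, (‖gQ j zbar + t • fderiv ℝ (gQ j) zbar s‖ - ‖gQ j zbar‖ + 0 / 2))) := by
      refine Tendsto.add (Tendsto.add ?_ ?_) ?_
      · exact ((((hf.continuous_fderiv one_ne_zero).clm_apply continuous_const).tendsto
          (xbar, zbar)).comp hxz).const_mul t
      · refine tendsto_finsetSum _ fun i _ => Tendsto.add ?_ (hε0.div_const 2)
        have hD := ((hgR i).continuous_fderiv one_ne_zero).clm_apply (continuous_const (y := r))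
        exact ((((hgRd i).continuous.add (hD.const_smul t)).norm.sub
          (hgRd i).continuous.norm).tendsto xbar).comp hx
      · refine tendsto_finsetSum _ fun j _ => Tendsto.add ?_ (hε0.div_const 2)
        have hD := ((hgQ j).continuous_fderiv one_ne_zero).clm_apply (continuous_const (y := s))
        exact ((((hgQd j).continuous.add (hD.const_smul t)).norm.sub
          (hgQd j).continuous.norm).tendsto zbar).comp hz
    have hlow := (hgrad.mul_const (‖r‖ + ‖s‖)).const_mul (-t)
    rw [zero_mul, mul_zero] at hlow
    simp only [zero_div, add_zero] at hlim
    refine le_of_tendsto_of_tendsto' hlow hlim fun k => ?_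
    set G := gradient (fun w => f w (zs k) + ∑ i, smoothedNorm (εs k) (gR i w)
      + ∑ j, smoothedNorm (εs k) (gQ j (zs k))) (xs k) with hG
    set K := gradient (fun w => f (xs k) w + ∑ i, smoothedNorm (εs k) (gR i (xs k))
      + ∑ j, smoothedNorm (εs k) (gQ j w)) (zs k) with hK
    have hGr : inner ℝ G r = Df (xs k, zs k) (r, 0)
        + ∑ i, fderiv ℝ (fun w => smoothedNorm (εs k) (gR i w)) (xs k) r := by
      have h1 : HasFDerivAt (fun w => f w (zs k))
          ((Df (xs k, zs k)).comp (.inl ℝ E F)) (xs k) :=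
        HasFDerivAt.comp (g := fun p : E × F => f p.1 p.2)
          (f := fun w => (w, zs k)) (xs k)
          (hfd (xs k, zs k)).hasFDerivAt (hasFDerivAt_prodMk_left (xs k) (zs k))
      have h2 := (h1.fun_add (HasFDerivAt.fun_sum (u := Finset.univ) fun i _ =>
        ((hgRd i (xs k)).smoothedNorm_comp (hεpos k)).hasFDerivAt)).add_const
        (∑ j, smoothedNorm (εs k) (gQ j (zs k)))
      rw [hG, gradient, h2.fderiv, InnerProductSpace.toDual_symm_apply]
      simp
    have hKs : inner ℝ K s = Df (xs k, zs k) (0, s)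
        + ∑ j, fderiv ℝ (fun w => smoothedNorm (εs k) (gQ j w)) (zs k) s := by
      have h1 : HasFDerivAt (fun w => f (xs k) w)
          ((Df (xs k, zs k)).comp (.inr ℝ E F)) (zs k) :=
        HasFDerivAt.comp (g := fun p : E × F => f p.1 p.2)
          (f := fun w => (xs k, w)) (zs k)
          (hfd (xs k, zs k)).hasFDerivAt (hasFDerivAt_prodMk_right (xs k) (zs k))
      have h2 := (h1.add_const (∑ i, smoothedNorm (εs k) (gR i (xs k)))).fun_add
        (HasFDerivAt.fun_sum (u := Finset.univ) fun j _ =>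
        ((hgQd j (zs k)).smoothedNorm_comp (hεpos k)).hasFDerivAt)
      rw [hK, gradient, h2.fderiv, InnerProductSpace.toDual_symm_apply]
      simp
    have hGn : ‖G‖ ≤ √(‖G‖ ^ 2 + ‖K‖ ^ 2) := Real.le_sqrt_of_sq_le (by nlinarith [sq_nonneg ‖K‖])
    have hKn : ‖K‖ ≤ √(‖G‖ ^ 2 + ‖K‖ ^ 2) := Real.le_sqrt_of_sq_le (by nlinarith [sq_nonneg ‖G‖])
    have hbound : -(√(‖G‖ ^ 2 + ‖K‖ ^ 2) * (‖r‖ + ‖s‖)) ≤ inner ℝ G r + inner ℝ K s := by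
      have h1 := (abs_le.1 (abs_real_inner_le_norm G r)).1
      have h2 := (abs_le.1 (abs_real_inner_le_norm K s)).1
      have h3 := mul_le_mul_of_nonneg_right hGn (norm_nonneg r)
      have h4 := mul_le_mul_of_nonneg_right hKn (norm_nonneg s)
      linarith
    have hsplit : Df (xs k, zs k) (r, s) = Df (xs k, zs k) (r, 0) + Df (xs k, zs k) (0, s) := by
      rw [← map_add]; simp
    calc -t * (√(‖G‖ ^ 2 + ‖K‖ ^ 2) * (‖r‖ + ‖s‖))
        ≤ t * (inner ℝ G r + inner ℝ K s) := by
          linarith [mul_le_mul_of_nonneg_left hbound ht.le]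
      _ = t * Df (xs k, zs k) (r, s)
          + ∑ i, t * fderiv ℝ (fun w => smoothedNorm (εs k) (gR i w)) (xs k) r
          + ∑ j, t * fderiv ℝ (fun w => smoothedNorm (εs k) (gQ j w)) (zs k) s := by
          rw [hGr, hKs, hsplit, ← Finset.mul_sum, ← Finset.mul_sum]; ring
      _ ≤ _ := by
          gcongr with i _ j _
          · exact mul_fderiv_smoothedNorm_comp_le (hεpos k) (hgRd i (xs k)) r t
          · exact mul_fderiv_smoothedNorm_comp_le (hεpos k) (hgQd j (zs k)) s t
  refine Real.sInf_nonneg fun a ha => ?_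
  have ha' : ∀ᶠ t in 𝓝[>] (0 : ℝ), _ :=
    (tendsto_const_nhds.prodMk tendsto_id :
      Tendsto (fun t : ℝ => ((xbar, zbar), t)) (𝓝[>] 0) (𝓝 (xbar, zbar) ×ˢ 𝓝[>] 0)).eventually
      (eventually_map.1 ha)
  have herr := (((hfd (xbar, zbar)).tendsto_linearization_error (r, s)).add
    (tendsto_finsetSum Finset.univ fun i _ =>
      (hgRd i xbar).tendsto_norm_linearization_error r)).add
    (tendsto_finsetSum Finset.univ fun j _ =>
      (hgQd j zbar).tendsto_norm_linearization_error s)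
  simp only [Finset.sum_const_zero, add_zero] at herr
  refine le_of_tendsto herr ?_
  filter_upwards [ha', self_mem_nhdsWithin] with t hta ht
  refine le_trans ?_ hta
  have hk := key t ht
  simp only [← Finset.mul_sum, smul_eq_mul, Finset.sum_sub_distrib, Prod.mk_add_mk,
    Prod.smul_mk] at hk ⊢
  rw [← mul_add, ← mul_add, div_eq_inv_mul]
  exact mul_le_mul_of_nonneg_left (by linarith) (inv_nonneg.2 (le_of_lt ht))
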